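/- arXiv:2512.00858 — 3 statements merged into one kernel-verified Lean document; each statement's English description precedes it below -/
import Mathlib

section
/- For every natural number n ≥ 2 and every real number k with 1 ≤ k ≤ n, one has 0 < n(k+1) − k² ≤ (21/4)^(n/3). -/
theorem lemn_aux (n : ℕ) (hn : 3 ≤ n) : ((n : ℝ) + (n : ℝ) ^ 2 / 4) ^ 3 ≤ (21 / 4 : ℝ) ^ n := by
  induction n, hn using Nat.le_induction with
  | base => norm_num
  | succ m hm ih =>
    have h3 : (3 : ℝ) ≤ m := by exact_mod_cast hm
    have h : ((m + 1 : ℕ) : ℝ) + ((m + 1 : ℕ) : ℝ) ^ 2 / 4 ≤ 8 / 5 * ((m : ℝ) + (m : ℝ) ^ 2 / 4) := by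
      push_cast
      nlinarith
    calc _ ≤ (8 / 5 * ((m : ℝ) + (m : ℝ) ^ 2 / 4)) ^ 3 := by gcongr
      _ = (8 / 5) ^ 3 * ((m : ℝ) + (m : ℝ) ^ 2 / 4) ^ 3 := by ring
      _ ≤ (21 / 4) * (21 / 4 : ℝ) ^ m := by
        gcongr
        norm_num
      _ = _ := by ring

/-- For every natural number `n ≥ 2` and every real `k` with `1 ≤ k ≤ n`,
`0 < n(k+1) − k² ≤ (21/4)^(n/3)`. -/
theorem lemniscate_basic2 (n : ℕ) (hn : 2 ≤ n) (k : ℝ) (hk1 : 1 ≤ k) (hkn : k ≤ (n : ℝ)) :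
    0 < (n : ℝ) * (k + 1) - k ^ 2 ∧
    (n : ℝ) * (k + 1) - k ^ 2 ≤ (21 / 4 : ℝ) ^ ((n : ℝ) / 3) := by
  constructor
  · nlinarith
  · have h1 : (n : ℝ) * (k + 1) - k ^ 2 ≤ (n : ℝ) + (n : ℝ) ^ 2 / 4 := by
      nlinarith [sq_nonneg (k - n / 2)]
    refine h1.trans ?_
    have h2 : ((n : ℝ) + (n : ℝ) ^ 2 / 4) ^ 3 ≤ (21 / 4 : ℝ) ^ n := by
      rcases Nat.lt_or_ge n 3 with h | h
      · obtain rfl : n = 2 := by omega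
        norm_num
      · exact lemn_aux n h
    have h3 : ((21 / 4 : ℝ) ^ ((n : ℝ) / 3)) ^ 3 = (21 / 4 : ℝ) ^ n := by
      rw [← Real.rpow_natCast, ← Real.rpow_mul (by norm_num), ← Real.rpow_natCast]
      congr 1
      push_cast
      ring
    refine le_of_pow_le_pow_left₀ (n := 3) (by norm_num) (by positivity) ?_
    rw [h3]
    exact h2
end

section
/- Let b be a real number with b > 1/2. Then for every real number x, the series ∑_{n=0}^{∞} x^n/(n! · (b)_n) and ∑_{n=0}^{∞} (4x)^n · (b − 1/2)_n/(n! · (b)_n · (2b − 1)_n) both converge absolutely, and ( ∑_{n=0}^{∞} x^n/(n! · (b)_n) )² = ∑_{n=0}^{∞} (4x)^n · (b − 1/2)_n/(n! · (b)_n · (2b − 1)_n). -/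
open Polynomial

lemma aux_left (n : ℕ) (a : ℝ) : (ascPochhammer ℝ (n+1)).eval a
    = a * (ascPochhammer ℝ n).eval (a+1) := by
  simp [ascPochhammer_succ_left, eval_comp]

lemma aux_sum (n : ℕ) : ∀ a b : ℝ, 0 < a → 0 < b →
    ∑ ij ∈ Finset.HasAntidiagonal.antidiagonal n, (n.choose ij.1 : ℝ) *
      (1 / ((ascPochhammer ℝ ij.1).eval a * (ascPochhammer ℝ ij.2).eval b)) =
    (ascPochhammer ℝ n).eval (a + b + n - 1) /
      ((ascPochhammer ℝ n).eval a * (ascPochhammer ℝ n).eval b) := by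
  induction n with
  | zero => intro a b _ _; simp
  | succ n ih =>
    intro a b ha hb
    rw [Finset.sum_antidiagonal_choose_succ_mul (fun i j => 1 / ((ascPochhammer ℝ i).eval a *
      (ascPochhammer ℝ j).eval b))]
    have h1 : ∑ ij ∈ Finset.HasAntidiagonal.antidiagonal n, (n.choose ij.1 : ℝ) *
        (1 / ((ascPochhammer ℝ ij.1).eval a * (ascPochhammer ℝ (ij.2+1)).eval b)) =
        1 / b * ((ascPochhammer ℝ n).eval (a + (b+1) + n - 1) /
      ((ascPochhammer ℝ n).eval a * (ascPochhammer ℝ n).eval (b+1))) := by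
      rw [← ih a (b+1) ha (by linarith), Finset.mul_sum]
      refine Finset.sum_congr rfl fun ij _ => ?_
      rw [aux_left]
      have := (ascPochhammer_pos ij.1 a ha).ne'
      have := (ascPochhammer_pos ij.2 (b+1) (by linarith)).ne'
      field_simp
    have h2 : ∑ ij ∈ Finset.HasAntidiagonal.antidiagonal n, (n.choose ij.2 : ℝ) *
        (1 / ((ascPochhammer ℝ (ij.1+1)).eval a * (ascPochhammer ℝ ij.2).eval b)) =
        1 / a * ((ascPochhammer ℝ n).eval ((a+1) + b + n - 1) /
      ((ascPochhammer ℝ n).eval (a+1) * (ascPochhammer ℝ n).eval b)) := by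
      rw [← ih (a+1) b (by linarith) hb, Finset.mul_sum]
      refine Finset.sum_congr rfl fun ij hij => ?_
      rw [aux_left, Nat.choose_symm_of_eq_add (Finset.HasAntidiagonal.mem_antidiagonal.1 hij).symm]
      have := (ascPochhammer_pos ij.1 (a+1) (by linarith)).ne'
      have := (ascPochhammer_pos ij.2 b hb).ne'
      field_simp
    rw [h1, h2]
    have e1 := aux_left n a
    have e2 := aux_left n b
    rw [ascPochhammer_succ_eval] at e1 e2
    have p1 := ascPochhammer_pos n a ha
    have p2 := ascPochhammer_pos n b hb
    have q1 : (ascPochhammer ℝ n).eval (a+1) = (ascPochhammer ℝ n).eval a * (a+n) / a := by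
      rw [e1]; field_simp
    have q2 : (ascPochhammer ℝ n).eval (b+1) = (ascPochhammer ℝ n).eval b * (b+n) / b := by
      rw [e2]; field_simp
    rw [q1, q2, ascPochhammer_succ_eval, ascPochhammer_succ_eval, ascPochhammer_succ_eval]
    have r1 : a + (b+1) + (n:ℝ) - 1 = a + b + n := by ring
    have r2 : (a+1) + b + (n:ℝ) - 1 = a + b + n := by ring
    have r3 : a + b + ((n+1 : ℕ) : ℝ) - 1 = a + b + n := by push_cast; ring
    rw [r1, r2, r3]
    have : 0 < a + n := by positivity
    have : 0 < b + n := by positivity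
    field_simp
    ring

lemma aux_dup (n : ℕ) (b : ℝ) :
    4 ^ n * (ascPochhammer ℝ n).eval (b - 1/2) * (ascPochhammer ℝ n).eval b
      = (ascPochhammer ℝ (n+n)).eval (2*b-1) := by
  induction n with
  | zero => simp
  | succ n ih =>
    rw [show n+1+(n+1) = n+n+1+1 by ring, ascPochhammer_succ_eval, ascPochhammer_succ_eval,
      ascPochhammer_succ_eval, ascPochhammer_succ_eval, ← ih]
    push_cast
    ring

lemma aux_add (n m : ℕ) (c : ℝ) : (ascPochhammer ℝ (n+m)).eval c =
    (ascPochhammer ℝ n).eval c * (ascPochhammer ℝ m).eval (c+n) := by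
  rw [← ascPochhammer_mul]; simp [eval_comp]

lemma aux_half (b : ℝ) (hb : 1/2 < b) (n : ℕ) : 1/2 ≤ (ascPochhammer ℝ n).eval b := by
  induction n with
  | zero => norm_num
  | succ n ih =>
    rw [ascPochhammer_succ_eval]
    rcases Nat.eq_zero_or_pos n with h | h
    · subst h; simp; linarith
    · have : (1:ℝ) ≤ n := by exact_mod_cast h
      nlinarith

lemma aux_mono (n : ℕ) (a c : ℝ) (ha : 0 < a) (hc : a ≤ c) :
    (ascPochhammer ℝ n).eval a ≤ (ascPochhammer ℝ n).eval c := by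
  induction n with
  | zero => simp
  | succ n ih =>
    rw [ascPochhammer_succ_eval, ascPochhammer_succ_eval]
    have := ascPochhammer_pos n c (by linarith)
    gcongr

lemma aux_s1 (b : ℝ) (hb : 1 / 2 < b) (x : ℝ) :
    Summable (fun n : ℕ => |x ^ n / ((n.factorial : ℝ) * (ascPochhammer ℝ n).eval b)|) := by
  refine Summable.of_nonneg_of_le (fun _ => abs_nonneg _) (fun n => ?_)
    ((Real.summable_pow_div_factorial |x|).mul_left 2)
  have h := aux_half b hb n
  have hf : (0:ℝ) < n.factorial := by exact_mod_cast n.factorial_pos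
  have hp : 0 < (ascPochhammer ℝ n).eval b := by linarith
  rw [abs_div, abs_pow, abs_of_pos (mul_pos hf hp), div_le_iff₀ (mul_pos hf hp)]
  have h0 : 0 ≤ |x| ^ n := by positivity
  have : 2 * (|x| ^ n / n.factorial) * (n.factorial * (ascPochhammer ℝ n).eval b)
    = |x|^n * (2 * (ascPochhammer ℝ n).eval b) := by field_simp
  rw [this]
  nlinarith

/-- For real `b > 1/2` and every real `x`, the series `∑ x^n/(n! (b)_n)` and
`∑ (4x)^n (b−1/2)_n/(n! (b)_n (2b−1)_n)` converge absolutely and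
`(∑ x^n/(n! (b)_n))² = ∑ (4x)^n (b−1/2)_n/(n! (b)_n (2b−1)_n)`. -/
theorem zeroF1_sq_eq_oneF2 (b : ℝ) (hb : 1 / 2 < b) (x : ℝ) :
    Summable (fun n : ℕ => |x ^ n / ((n.factorial : ℝ) * (ascPochhammer ℝ n).eval b)|) ∧
    Summable (fun n : ℕ =>
      |(4 * x) ^ n * (ascPochhammer ℝ n).eval (b - 1 / 2) /
        ((n.factorial : ℝ) * (ascPochhammer ℝ n).eval b *
          (ascPochhammer ℝ n).eval (2 * b - 1))|) ∧
    (∑' n : ℕ, x ^ n / ((n.factorial : ℝ) * (ascPochhammer ℝ n).eval b)) ^ 2 =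
      ∑' n : ℕ, (4 * x) ^ n * (ascPochhammer ℝ n).eval (b - 1 / 2) /
        ((n.factorial : ℝ) * (ascPochhammer ℝ n).eval b *
          (ascPochhammer ℝ n).eval (2 * b - 1)) := by
  have S1 := aux_s1 b hb x
  have S2 : Summable (fun n : ℕ => ‖x ^ n / ((n.factorial : ℝ) * (ascPochhammer ℝ n).eval b)‖) := by
    simpa only [Real.norm_eq_abs] using S1
  refine ⟨S1, ?_, ?_⟩
  · refine Summable.of_nonneg_of_le (fun _ => abs_nonneg _) (fun n => ?_) (aux_s1 b hb (4*x))
    have h := aux_half b hb n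
    have hf : (0:ℝ) < n.factorial := by exact_mod_cast n.factorial_pos
    have hp : 0 < (ascPochhammer ℝ n).eval b := by linarith
    have h1 := ascPochhammer_pos n (b-1/2) (by linarith)
    have h2 := ascPochhammer_pos n (2*b-1) (by linarith)
    have h3 := aux_mono n (b-1/2) (2*b-1) (by linarith) (by linarith)
    rw [mul_div_mul_comm, abs_mul, abs_of_pos (div_pos h1 h2)]
    exact mul_le_of_le_one_right (abs_nonneg _) ((div_le_one h2).2 h3)
  · rw [sq, tsum_mul_tsum_eq_tsum_sum_antidiagonal_of_summable_norm S2 S2]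
    refine tsum_congr fun n => ?_
    have hf : (0:ℝ) < n.factorial := by exact_mod_cast n.factorial_pos
    have hp := ascPochhammer_pos n b (by linarith)
    have h2 := ascPochhammer_pos n (2*b-1) (by linarith)
    have key : ∑ kl ∈ Finset.HasAntidiagonal.antidiagonal n,
        x ^ kl.1 / ((kl.1.factorial : ℝ) * (ascPochhammer ℝ kl.1).eval b) *
        (x ^ kl.2 / ((kl.2.factorial : ℝ) * (ascPochhammer ℝ kl.2).eval b)) =
        x ^ n / n.factorial * ((ascPochhammer ℝ n).eval (b + b + n - 1) /
          ((ascPochhammer ℝ n).eval b * (ascPochhammer ℝ n).eval b)) := by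
      rw [← aux_sum n b b (by linarith) (by linarith), Finset.mul_sum]
      refine Finset.sum_congr rfl fun ij hij => ?_
      obtain ⟨i, j⟩ := ij
      obtain rfl : i + j = n := Finset.HasAntidiagonal.mem_antidiagonal.1 hij
      have c := Nat.add_choose_mul_factorial_mul_factorial i j
      have c' : ((i+j).choose i : ℝ) * i.factorial * j.factorial = (i+j).factorial := by
        rw [Nat.choose_symm_add]; exact_mod_cast c
      have := (ascPochhammer_pos i b (by linarith)).ne'
      have := (ascPochhammer_pos j b (by linarith)).ne'
      have : (i.factorial : ℝ) ≠ 0 := by exact_mod_cast i.factorial_ne_zero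
      have : (j.factorial : ℝ) ≠ 0 := by exact_mod_cast j.factorial_ne_zero
      simp only
      rw [pow_add]
      field_simp
      linear_combination -(x^i*x^j)*c'
    rw [key]
    have d := aux_dup n b
    rw [aux_add, show 2*b-1+(n:ℝ) = b+b+n-1 by ring] at d
    rw [mul_pow]
    clear key
    generalize eval (b+b+(n:ℝ)-1) (ascPochhammer ℝ n) = A at *
    generalize eval (2*b-1) (ascPochhammer ℝ n) = B at *
    generalize eval (b-1/2) (ascPochhammer ℝ n) = C at *
    generalize eval b (ascPochhammer ℝ n) = D at *
    field_simp
    linear_combination -(x^n)*d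
end

section
/- For every real number a, one has exp(21^(1/3)/(2^(5/3)·√(a² + 9/4))) − exp(1/(2·√(a² + 9/4))) ≤ exp(21^(1/3)/(3·2^(2/3))) − exp(1/3), and moreover exp(21^(1/3)/(3·2^(2/3))) − exp(1/3) < 1. -/
theorem aux_mono_s16 (c x y : ℝ) (hc : 1 ≤ c) (hx : 0 ≤ x) (hxy : x ≤ y) :
    Real.exp (c * x) - Real.exp x ≤ Real.exp (c * y) - Real.exp y := by
  have h : ∀ t : ℝ, Real.exp (c * t) - Real.exp t
      = Real.exp t * (Real.exp ((c - 1) * t) - 1) := by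
    intro t
    rw [mul_sub, ← Real.exp_add, mul_one]
    congr 2
    ring
  rw [h, h]
  have h1 : Real.exp x ≤ Real.exp y := Real.exp_le_exp.mpr hxy
  have h2 : Real.exp ((c - 1) * x) ≤ Real.exp ((c - 1) * y) :=
    Real.exp_le_exp.mpr (mul_le_mul_of_nonneg_left hxy (by linarith))
  have h3 : 1 ≤ Real.exp ((c - 1) * x) :=
    Real.one_le_exp (mul_nonneg (by linarith) hx)
  exact mul_le_mul h1 (by linarith) (by linarith) (Real.exp_pos y).le

/-- The function `𝔥(a) = exp(21^(1/3)/(2^(5/3)√(a²+9/4))) − exp(1/(2√(a²+9/4)))` attains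
its maximum on `ℝ` at `a = 0`, and this maximum value is strictly less than `1`. -/
theorem h_max_at_zero_lt_one :
    (∀ a : ℝ,
      Real.exp ((21 : ℝ) ^ ((1 : ℝ) / 3) /
          ((2 : ℝ) ^ ((5 : ℝ) / 3) * Real.sqrt (a ^ 2 + 9 / 4))) -
        Real.exp (1 / (2 * Real.sqrt (a ^ 2 + 9 / 4))) ≤
      Real.exp ((21 : ℝ) ^ ((1 : ℝ) / 3) / (3 * (2 : ℝ) ^ ((2 : ℝ) / 3))) -
        Real.exp (1 / 3)) ∧
    Real.exp ((21 : ℝ) ^ ((1 : ℝ) / 3) / (3 * (2 : ℝ) ^ ((2 : ℝ) / 3))) -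
      Real.exp (1 / 3) < 1 := by
  have h5 : (2 : ℝ) ^ ((5 : ℝ) / 3) = 2 * (2 : ℝ) ^ ((2 : ℝ) / 3) := by
    rw [show (5 : ℝ) / 3 = 1 + 2 / 3 by norm_num, Real.rpow_add (by norm_num), Real.rpow_one]
  have h4 : (2 : ℝ) ^ ((2 : ℝ) / 3) = (4 : ℝ) ^ ((1 : ℝ) / 3) := by
    rw [show (4 : ℝ) = 2 ^ (2 : ℝ) by norm_num, ← Real.rpow_mul (by norm_num)]
    norm_num
  have h32 : (32 : ℝ) ^ ((1 : ℝ) / 3) = 2 * (2 : ℝ) ^ ((2 : ℝ) / 3) := by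
    rw [← h5, show (32 : ℝ) = 2 ^ (5 : ℝ) by norm_num, ← Real.rpow_mul (by norm_num)]
    norm_num
  have hA : (4 : ℝ) ^ ((1 : ℝ) / 3) ≤ (21 : ℝ) ^ ((1 : ℝ) / 3) :=
    Real.rpow_le_rpow (by norm_num) (by norm_num) (by norm_num)
  have hB : (21 : ℝ) ^ ((1 : ℝ) / 3) ≤ (32 : ℝ) ^ ((1 : ℝ) / 3) :=
    Real.rpow_le_rpow (by norm_num) (by norm_num) (by norm_num)
  have hp : 0 < (2 : ℝ) ^ ((2 : ℝ) / 3) := by positivity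
  rw [← h4] at hA
  rw [h32] at hB
  rw [h5]
  generalize (2 : ℝ) ^ ((2 : ℝ) / 3) = p at *
  generalize (21 : ℝ) ^ ((1 : ℝ) / 3) = q at *
  have hc : 1 ≤ q / p := by rwa [le_div_iff₀ hp, one_mul]
  have hc2 : q / p ≤ 2 := by rwa [div_le_iff₀ hp]
  have e3 : q / (3 * p) = q / p * (1 / 3) := by field_simp
  rw [e3]
  constructor
  · intro a
    have hs : 3 / 2 ≤ Real.sqrt (a ^ 2 + 9 / 4) :=
      Real.le_sqrt_of_sq_le (by nlinarith [sq_nonneg a])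
    generalize Real.sqrt (a ^ 2 + 9 / 4) = s at *
    have hs0 : 0 < s := by linarith
    have e : q / (2 * p * s) = q / p * (1 / (2 * s)) := by field_simp
    rw [e]
    refine aux_mono_s16 _ _ _ hc (by positivity) ?_
    exact one_div_le_one_div_of_le (by norm_num) (by linarith)
  · have h1 : Real.exp (q / p * (1 / 3)) ≤ Real.exp (1 / 3) ^ 2 := by
      rw [← Real.exp_nat_mul]
      apply Real.exp_le_exp.mpr
      push_cast
      linarith
    have h2 : Real.exp (1 / 3) ^ 3 = Real.exp 1 := by
      rw [← Real.exp_nat_mul]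
      norm_num
    have h3 := Real.exp_one_lt_d9
    have h6 := Real.exp_pos (1 / 3)
    have h7 : Real.exp (1 / 3) < 3 / 2 := by
      apply lt_of_pow_lt_pow_left₀ 3 (by norm_num)
      rw [h2]
      norm_num at h3 ⊢
      linarith
    nlinarith
end
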